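/- Let d ≥ 2, let V satisfy the growth condition V(x) ≥ a|x|^q − R with a > 0, q > 1, let p ∈ (1, q), and let φ : ℝ^d → ℝ be Lipschitz, non-constant, such that there exist probability measures μ_−, μ_+ of finite electrostatic energy with ∫φ dμ_− < 0 and ∫φ dμ_+ > 0. Then the set B = {ν ∈ P_p(ℝ^d) : ∫φ dν ≤ 0} is closed in the p-Wasserstein topology and satisfies inf_{int(B)} E = inf_B E < +∞, where the interior is taken in the p-Wasserstein topology. -/

import Mathlib

open MeasureTheory Filter Metric
open scoped ENNReal NNReal RealInnerProductSpace BigOperators Topology ProbabilityTheory Classical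

noncomputable section

/-- `ℝ^d` as a Euclidean space. -/
abbrev Euc (d : ℕ) : Type := EuclideanSpace ℝ (Fin d)

/-- The Coulomb kernel `g`, valued in `ℝ ∪ {+∞}` (`= ⊤` at the origin). -/
noncomputable def coulombK (d : ℕ) (x : Euc d) : EReal :=
  if x = 0 then ⊤
  else if d = 2 then ((Real.log (1 / ‖x‖) : ℝ) : EReal)
  else ((1 / (((d : ℝ) - 2) * ‖x‖ ^ ((d : ℕ) - 2)) : ℝ) : EReal)

/-- Positive part of an extended real, as an extended nonnegative real. -/
noncomputable def posP (x : EReal) : ℝ≥0∞ := if x = ⊤ then ⊤ else ENNReal.ofReal x.toReal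

/-- The electrostatic energy `E(μ) = ∬ (g(x-y) + (V x + V y)/2) dμ dμ`, valued in `EReal`,
defined as the difference of the integrals of the positive and negative parts of the
integrand. -/
noncomputable def energy (d : ℕ) (V : Euc d → ℝ) (μ : Measure (Euc d)) : EReal :=
  ((∫⁻ q : Euc d × Euc d,
      posP (coulombK d (q.1 - q.2) + (((V q.1 + V q.2) / 2 : ℝ) : EReal)) ∂(μ.prod μ) : ℝ≥0∞) : EReal)
  - ((∫⁻ q : Euc d × Euc d,
      posP (-(coulombK d (q.1 - q.2) + (((V q.1 + V q.2) / 2 : ℝ) : EReal))) ∂(μ.prod μ) : ℝ≥0∞) : EReal)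

/-- Finiteness of the `p`-th moment of a measure on `ℝ^d`. -/
def FiniteMoment (d : ℕ) (p : ℝ) (μ : Measure (Euc d)) : Prop :=
  ∫⁻ x, ENNReal.ofReal (‖x‖ ^ p) ∂μ ≠ ⊤

/-- Couplings of two measures. -/
def Couplings (d : ℕ) (μ ν : Measure (Euc d)) : Set (Measure (Euc d × Euc d)) :=
  {π | π.map Prod.fst = μ ∧ π.map Prod.snd = ν}

/-- The `p`-Wasserstein distance (valued in `ℝ≥0∞`). -/
noncomputable def wassDist (d : ℕ) (p : ℝ) (μ ν : Measure (Euc d)) : ℝ≥0∞ :=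
  (⨅ π ∈ Couplings d μ ν, ∫⁻ q : Euc d × Euc d, ENNReal.ofReal (‖q.1 - q.2‖ ^ p) ∂π) ^ (1 / p)

/-- Real-valued Coulomb kernel (junk value at the origin; only used in densities with
respect to Lebesgue measure, for which the diagonal is negligible). -/
noncomputable def coulombKR (d : ℕ) (x : Euc d) : ℝ :=
  if d = 2 then Real.log (1 / ‖x‖) else 1 / (((d : ℝ) - 2) * ‖x‖ ^ ((d : ℕ) - 2))

/-- The Coulomb gas Hamiltonian `H_n`. -/
noncomputable def hamiltonian (d n : ℕ) (V : Euc d → ℝ) (x : Fin n → Euc d) : ℝ :=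
  (1 / (n : ℝ)) * ∑ i, V (x i)
    + (1 / (n : ℝ) ^ 2) *
        ∑ q ∈ Finset.univ.filter (fun q : Fin n × Fin n => q.1 ≠ q.2), coulombKR d (x q.1 - x q.2)

/-- The Gibbs measure `P_n` with density proportional to `exp(-β H_n)`. -/
noncomputable def gibbs (d n : ℕ) (β : ℝ) (V : Euc d → ℝ) : Measure (Fin n → Euc d) :=
  ((∫⁻ x, ENNReal.ofReal (Real.exp (-β * hamiltonian d n V x)) ∂(Measure.pi fun _ => volume))⁻¹) •
    (Measure.pi fun _ => (volume : Measure (Euc d))).withDensity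
      (fun x => ENNReal.ofReal (Real.exp (-β * hamiltonian d n V x)))

/-- Empirical measure of a configuration. -/
noncomputable def empMeas (d n : ℕ) (x : Fin n → Euc d) : Measure (Euc d) :=
  ((n : ℝ≥0∞))⁻¹ • ∑ i, Measure.dirac (x i)

/-- Uniform probability measure on the closed ball of radius 1 centered at `c`. -/
noncomputable def uniformBall (d : ℕ) (c : Euc d) : Measure (Euc d) :=
  (volume (Metric.closedBall c 1))⁻¹ • volume.restrict (Metric.closedBall c 1)

/-- Support of a measure. -/
def measSupport (d : ℕ) (μ : Measure (Euc d)) : Set (Euc d) :=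
  {x | ∀ U : Set (Euc d), IsOpen U → x ∈ U → μ U ≠ 0}

/-- The Coulomb interaction energy `J(μ) = ∬ g(x-y) dμ dμ` (the energy with `V = 0`). -/
noncomputable def interactionJ (d : ℕ) (μ : Measure (Euc d)) : EReal :=
  energy d (fun _ => 0) μ

/-- A set has null capacity if it contains no compact set carrying a probability measure
of finite Coulomb interaction energy. -/
def NullCapacity (d : ℕ) (A : Set (Euc d)) : Prop :=
  ∀ K : Set (Euc d), K ⊆ A → IsCompact K →
    ∀ μ : Measure (Euc d), IsProbabilityMeasure μ → μ Kᶜ = 0 → interactionJ d μ = ⊤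

/-- A property holds quasi-everywhere if it holds outside a Borel set of null capacity. -/
def QuasiEverywhere (d : ℕ) (P : Euc d → Prop) : Prop :=
  ∃ N : Set (Euc d), MeasurableSet N ∧ NullCapacity d N ∧ ∀ x ∉ N, P x

/-- The Coulomb potential `(g * μ)(x) = ∫ g(x - y) μ(dy)`, valued in `EReal`. -/
noncomputable def coulombPot (d : ℕ) (μ : Measure (Euc d)) (x : Euc d) : EReal :=
  ((∫⁻ y, posP (coulombK d (x - y)) ∂μ : ℝ≥0∞) : EReal)
  - ((∫⁻ y, posP (-(coulombK d (x - y))) ∂μ : ℝ≥0∞) : EReal)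

/-- The set `P_p(ℝ^d)` of probability measures with finite `p`-th moment. -/
def Ppd (d : ℕ) (p : ℝ) : Set (Measure (Euc d)) :=
  {μ | IsProbabilityMeasure μ ∧ FiniteMoment d p μ}

/-- `B` is closed in the `p`-Wasserstein topology (within `P_p(ℝ^d)`). -/
def WClosedIn (d : ℕ) (p : ℝ) (B : Set (Measure (Euc d))) : Prop :=
  ∀ μ ∈ Ppd d p, (∀ ε : ℝ, 0 < ε → ∃ ν ∈ B, wassDist d p μ ν < ENNReal.ofReal ε) → μ ∈ B

/-- Interior of `B` in the `p`-Wasserstein topology (within `P_p(ℝ^d)`). -/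
def wInterior (d : ℕ) (p : ℝ) (B : Set (Measure (Euc d))) : Set (Measure (Euc d)) :=
  {μ | μ ∈ B ∧ ∃ ε : ℝ, 0 < ε ∧ ∀ ν ∈ Ppd d p, wassDist d p μ ν < ENNReal.ofReal ε → ν ∈ B}

/-- The growth condition `V(x) ≥ a |x|^q - R`. -/
def GrowthCond (d : ℕ) (V : Euc d → ℝ) (a q R : ℝ) : Prop :=
  ∀ x : Euc d, a * ‖x‖ ^ q - R ≤ V x


theorem posP_eq (x : EReal) : posP x = x.toENNReal := by
  unfold posP EReal.toENNReal
  congr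

theorem measurable_coulombK (d : ℕ) : Measurable (coulombK d) := by
  unfold coulombK
  refine Measurable.ite (measurableSet_singleton 0) measurable_const ?_
  split_ifs
  · exact (by fun_prop : Measurable fun x : Euc d => Real.log (1 / ‖x‖)).coe_real_ereal
  · exact (by fun_prop : Measurable fun x : Euc d =>
      (1 / (((d : ℝ) - 2) * ‖x‖ ^ ((d : ℕ) - 2)))).coe_real_ereal

/-- Superlevel sets of the Coulomb kernel are balls. -/
theorem level_ball (d : ℕ) (hd : 2 ≤ d) (t : ℝ) (ht : 0 < t) :
    ∃ r : ℝ, 0 < r ∧ ∀ x : Euc d, (t : EReal) < coulombK d x ↔ ‖x‖ < r := by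
  rcases hd.eq_or_lt with h2 | h3
  · refine ⟨Real.exp (-t), Real.exp_pos _, fun x => ?_⟩
    unfold coulombK
    by_cases hx : x = 0
    · simp [hx, Real.exp_pos]
    · have hx' : 0 < ‖x‖ := norm_pos_iff.2 hx
      rw [if_neg hx, if_pos h2.symm, EReal.coe_lt_coe_iff, one_div, Real.log_inv,
        ← Real.log_lt_iff_lt_exp hx']
      constructor <;> intro h <;> linarith
  · have hd' : (0 : ℝ) < (d : ℝ) - 2 := by
      have : (2 : ℝ) < d := by exact_mod_cast h3
      linarith
    have hn : d - 2 ≠ 0 := by omega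
    have hc : 0 < 1 / (((d : ℝ) - 2) * t) := by positivity
    refine ⟨(1 / (((d : ℝ) - 2) * t)) ^ (((d - 2 : ℕ) : ℝ)⁻¹), Real.rpow_pos_of_pos hc _,
      fun x => ?_⟩
    unfold coulombK
    by_cases hx : x = 0
    · have := Real.rpow_pos_of_pos hc (((d - 2 : ℕ) : ℝ)⁻¹)
      simpa [hx] using this
    · have hx' : 0 < ‖x‖ := norm_pos_iff.2 hx
      rw [if_neg hx, if_neg (by omega), EReal.coe_lt_coe_iff,
        ← pow_lt_pow_iff_left₀ hx'.le (Real.rpow_nonneg hc.le _) hn,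
        Real.rpow_inv_natCast_pow hc.le hn]
      rw [lt_div_iff₀ (by positivity), lt_div_iff₀ (by positivity)]
      constructor <;> intro h <;> nlinarith

theorem layer (e : EReal) :
    e.toENNReal = ∫⁻ t in Set.Ioi (0 : ℝ), {t : ℝ | (t : EReal) < e}.indicator 1 t := by
  have hm : MeasurableSet {t : ℝ | (t : EReal) < e} :=
    measurableSet_lt measurable_coe_real_ereal measurable_const
  rw [lintegral_indicator_one hm, Measure.restrict_apply hm]
  induction e with
  | bot => simp
  | top => simp
  | coe x =>
    have : {t : ℝ | (t : EReal) < (x : EReal)} ∩ Set.Ioi 0 = Set.Ioo 0 x := by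
      ext t; simp [and_comm]
    rw [this]; simp

theorem ball_prod {d : ℕ} (μ ν : Measure (Euc d)) [IsProbabilityMeasure μ]
    [IsProbabilityMeasure ν] (s : ℝ) :
    ∫⁻ q : Euc d × Euc d, volume (ball q.1 s ∩ ball q.2 s) ∂(μ.prod ν)
      = ∫⁻ z : Euc d, μ (ball z s) * ν (ball z s) := by
  have hS : MeasurableSet {w : (Euc d × Euc d) × Euc d | w.2 ∈ ball w.1.1 s ∩ ball w.1.2 s} := by
    have h1 : MeasurableSet {w : (Euc d × Euc d) × Euc d | dist w.2 w.1.1 < s} :=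
      measurableSet_lt (by fun_prop) measurable_const
    have h2 : MeasurableSet {w : (Euc d × Euc d) × Euc d | dist w.2 w.1.2 < s} :=
      measurableSet_lt (by fun_prop) measurable_const
    exact h1.inter h2
  have e1 := Measure.prod_apply (μ := μ.prod ν) (ν := (volume : Measure (Euc d))) hS
  have e2 := Measure.prod_apply_symm (μ := μ.prod ν) (ν := (volume : Measure (Euc d))) hS
  rw [e1] at e2
  have : ∀ z : Euc d, μ (ball z s) * ν (ball z s) = μ.prod ν (ball z s ×ˢ ball z s) := fun z => by
    rw [Measure.prod_prod]
  simp_rw [this]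
  refine Eq.trans ?_ (e2.trans ?_)
  · rfl
  · congr 1
    ext z
    congr 1
    ext q
    simp [mem_ball, dist_comm]

theorem ball_key {d : ℕ} (μ ν : Measure (Euc d)) [IsProbabilityMeasure μ]
    [IsProbabilityMeasure ν] (r : ℝ) (hr : 0 < r) :
    (μ.prod ν) {q | ‖q.1 - q.2‖ < r} ≤
      2 ^ d * ((μ.prod μ) {q | ‖q.1 - q.2‖ < 4 * r} + (ν.prod ν) {q | ‖q.1 - q.2‖ < 4 * r}) := by
  have hmeas : ∀ s : ℝ, MeasurableSet {q : Euc d × Euc d | ‖q.1 - q.2‖ < s} := fun s =>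
    measurableSet_lt (by fun_prop) measurable_const
  have hB : ∀ (x : Euc d), volume (ball x r) = volume (ball (0 : Euc d) r) := fun x =>
    Measure.addHaar_ball_center _ _ _
  have hB2 : ∀ (x : Euc d), volume (ball x (2 * r)) = 2 ^ d * volume (ball (0 : Euc d) r) :=
      fun x => by
    rw [Measure.addHaar_ball_mul_of_pos _ _ two_pos]
    simp
  have hpos : volume (ball (0 : Euc d) r) ≠ 0 := (measure_ball_pos _ _ hr).ne'
  have hfin : volume (ball (0 : Euc d) r) ≠ ⊤ := measure_ball_lt_top.ne
  have low : volume (ball (0 : Euc d) r) * (μ.prod ν) {q | ‖q.1 - q.2‖ < r} ≤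
      ∫⁻ q : Euc d × Euc d, volume (ball q.1 (2*r) ∩ ball q.2 (2*r)) ∂(μ.prod ν) := by
    rw [← lintegral_indicator_const (hmeas r)]
    apply lintegral_mono
    intro q
    by_cases hq : ‖q.1 - q.2‖ < r
    · rw [Set.indicator_of_mem (by exact hq), ← hB q.1]
      apply measure_mono
      intro z hz
      rw [mem_ball] at hz
      refine ⟨?_, ?_⟩
      · rw [mem_ball]; linarith
      · rw [mem_ball]
        have := dist_triangle z q.1 q.2
        rw [dist_eq_norm q.1 q.2] at this
        linarith
    · rw [Set.indicator_of_notMem (by exact hq)]; exact zero_le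
  have up : ∀ ρ : Measure (Euc d), IsProbabilityMeasure ρ →
      ∫⁻ q : Euc d × Euc d, volume (ball q.1 (2*r) ∩ ball q.2 (2*r)) ∂(ρ.prod ρ) ≤
      2 ^ d * volume (ball (0 : Euc d) r) * (ρ.prod ρ) {q | ‖q.1 - q.2‖ < 4 * r} := by
    intro ρ _
    rw [← lintegral_indicator_const (hmeas (4*r))]
    apply lintegral_mono
    intro q
    by_cases hq : ‖q.1 - q.2‖ < 4 * r
    · rw [Set.indicator_of_mem (by exact hq), ← hB2 q.1]
      exact measure_mono Set.inter_subset_left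
    · rw [Set.indicator_of_notMem (by exact hq)]
      have : ball q.1 (2*r) ∩ ball q.2 (2*r) = ∅ := by
        ext z
        simp only [Set.mem_inter_iff, mem_ball, Set.mem_empty_iff_false, iff_false, not_and]
        intro h1 h2
        apply hq
        have := dist_triangle_left q.1 q.2 z
        rw [dist_eq_norm q.1 q.2] at this
        linarith
      show volume (ball q.1 (2*r) ∩ ball q.2 (2*r)) ≤ 0
      rw [this]; simp
  have hmz : ∀ ρ : Measure (Euc d), IsProbabilityMeasure ρ →
      Measurable fun z : Euc d => ρ (ball z (2 * r)) := by
    intro ρ _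
    have hS : MeasurableSet {w : Euc d × Euc d | dist w.2 w.1 < 2 * r} :=
      measurableSet_lt (by fun_prop) measurable_const
    exact measurable_measure_prodMk_left hS
  have mid : ∫⁻ z : Euc d, μ (ball z (2*r)) * ν (ball z (2*r)) ≤
      (∫⁻ z : Euc d, μ (ball z (2*r)) * μ (ball z (2*r))) +
      ∫⁻ z : Euc d, ν (ball z (2*r)) * ν (ball z (2*r)) := by
    have hmm : Measurable fun z : Euc d => μ (ball z (2*r)) * μ (ball z (2*r)) :=
      (hmz μ inferInstance).mul (hmz μ inferInstance)
    rw [← lintegral_add_left hmm]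
    apply lintegral_mono
    intro z
    show μ (ball z (2*r)) * ν (ball z (2*r)) ≤ μ (ball z (2*r)) * μ (ball z (2*r)) +
      ν (ball z (2*r)) * ν (ball z (2*r))
    rcases le_total (μ (ball z (2*r))) (ν (ball z (2*r))) with h | h
    · exact (mul_le_mul_left h _).trans le_add_self
    · exact (mul_le_mul_right h _).trans le_self_add
  have fin := (low.trans_eq (ball_prod μ ν _)).trans mid
  rw [← ball_prod μ μ, ← ball_prod ν ν] at fin
  have fin2 := fin.trans (add_le_add (up μ inferInstance) (up ν inferInstance))
  rw [← ENNReal.mul_le_mul_iff_right hpos hfin]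
  refine fin2.trans_eq ?_
  ring

theorem measurable_posg (d : ℕ) (c : ℝ) :
    Measurable fun q : Euc d × Euc d => (coulombK d (c • (q.1 - q.2))).toENNReal :=
  ((measurable_coulombK d).comp (by fun_prop)).ereal_toENNReal

theorem layer_prod {d : ℕ} (μ ν : Measure (Euc d)) [IsProbabilityMeasure μ]
    [IsProbabilityMeasure ν] (c : ℝ) :
    ∫⁻ q : Euc d × Euc d, (coulombK d (c • (q.1 - q.2))).toENNReal ∂(μ.prod ν) =
    ∫⁻ t in Set.Ioi (0 : ℝ), (μ.prod ν) {q | (t : EReal) < coulombK d (c • (q.1 - q.2))} := by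
  have hS : MeasurableSet {w : (Euc d × Euc d) × ℝ |
      (w.2 : EReal) < coulombK d (c • (w.1.1 - w.1.2))} :=
    measurableSet_lt (measurable_coe_real_ereal.comp measurable_snd)
      ((measurable_coulombK d).comp (by fun_prop))
  have e1 := Measure.prod_apply (μ := μ.prod ν)
    (ν := (volume : Measure ℝ).restrict (Set.Ioi 0)) hS
  have e2 := Measure.prod_apply_symm (μ := μ.prod ν)
    (ν := (volume : Measure ℝ).restrict (Set.Ioi 0)) hS
  rw [e1] at e2
  refine Eq.trans ?_ e2
  congr 1
  ext q
  have hm : MeasurableSet {t : ℝ | (t : EReal) < coulombK d (c • (q.1 - q.2))} :=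
    measurableSet_lt measurable_coe_real_ereal measurable_const
  rw [layer, lintegral_indicator_one hm]
  rfl

theorem cross_g {d : ℕ} (hd : 2 ≤ d) (μ ν : Measure (Euc d)) [IsProbabilityMeasure μ]
    [IsProbabilityMeasure ν] :
    ∫⁻ q : Euc d × Euc d, (coulombK d (q.1 - q.2)).toENNReal ∂(μ.prod ν) ≤
    2 ^ d * (∫⁻ q : Euc d × Euc d, (coulombK d ((1/4 : ℝ) • (q.1 - q.2))).toENNReal ∂(μ.prod μ) +
      ∫⁻ q : Euc d × Euc d, (coulombK d ((1/4 : ℝ) • (q.1 - q.2))).toENNReal ∂(ν.prod ν)) := by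
  have h := layer_prod μ ν 1
  simp only [one_smul] at h
  rw [h, layer_prod μ μ, layer_prod ν ν]
  have hm : ∀ ρ : Measure (Euc d), IsProbabilityMeasure ρ → Measurable fun t : ℝ =>
      (ρ.prod ρ) {q | (t : EReal) < coulombK d ((1/4 : ℝ) • (q.1 - q.2))} := by
    intro ρ _
    have hS : MeasurableSet {w : ℝ × (Euc d × Euc d) |
        (w.1 : EReal) < coulombK d ((1/4 : ℝ) • (w.2.1 - w.2.2))} :=
      measurableSet_lt (measurable_coe_real_ereal.comp measurable_fst)
        ((measurable_coulombK d).comp (by fun_prop))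
    exact measurable_measure_prodMk_left hS
  have hmm : Measurable fun t : ℝ =>
      (μ.prod μ) {q | (t : EReal) < coulombK d ((1/4 : ℝ) • (q.1 - q.2))} +
      (ν.prod ν) {q | (t : EReal) < coulombK d ((1/4 : ℝ) • (q.1 - q.2))} :=
    (hm μ inferInstance).add (hm ν inferInstance)
  rw [← lintegral_add_left (hm μ inferInstance), ← lintegral_const_mul _ hmm]
  apply setLIntegral_mono (hmm.const_mul _)
  intro t ht
  obtain ⟨r, hr, hlev⟩ := level_ball d hd t ht
  simp only [hlev]
  have hn : ∀ q : Euc d × Euc d, ‖(1/4 : ℝ) • (q.1 - q.2)‖ < r ↔ ‖q.1 - q.2‖ < 4 * r := by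
    intro q
    rw [norm_smul, Real.norm_of_nonneg (by norm_num)]
    constructor <;> intro h <;> linarith
  simp only [hn]
  exact ball_key μ ν r hr

theorem scale_g {d : ℕ} (hd : 2 ≤ d) (x : Euc d) :
    (coulombK d ((1/4 : ℝ) • x)).toENNReal ≤
      4 ^ d * (coulombK d x).toENNReal + ENNReal.ofReal (Real.log 4) := by
  by_cases hx : x = 0
  · simp [hx, coulombK]
  have hx' : 0 < ‖x‖ := norm_pos_iff.2 hx
  have h4 : (1/4 : ℝ) • x ≠ 0 := smul_ne_zero (by norm_num) hx
  have hnorm : ‖(1/4 : ℝ) • x‖ = ‖x‖ / 4 := by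
    rw [norm_smul, Real.norm_of_nonneg (by norm_num)]; ring
  have hE : (4 : ℝ≥0∞) ^ d = ENNReal.ofReal (4 ^ d) := by
    rw [ENNReal.ofReal_pow (by norm_num)]; simp
  have h1 : (1 : ℝ) ≤ 4 ^ d := one_le_pow₀ (by norm_num)
  unfold coulombK
  rw [if_neg h4, if_neg hx, hnorm]
  split_ifs with h2
  · simp only [EReal.real_coe_toENNReal]
    have : Real.log (1 / (‖x‖ / 4)) = Real.log (1 / ‖x‖) + Real.log 4 := by
      rw [← Real.log_mul (by positivity) (by norm_num)]; congr 1; field_simp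
    rw [this]
    refine ENNReal.ofReal_add_le.trans ?_
    gcongr
    calc _ = 1 * ENNReal.ofReal (Real.log (1 / ‖x‖)) := by simp
      _ ≤ _ := by gcongr; exact one_le_pow₀ (by norm_num)
  · simp only [EReal.real_coe_toENNReal]
    refine le_trans ?_ le_self_add
    rw [hE, ← ENNReal.ofReal_mul (by positivity)]
    apply ENNReal.ofReal_le_ofReal
    have hd' : (0 : ℝ) < (d : ℝ) - 2 := by
      have : (2 : ℝ) < d := by exact_mod_cast lt_of_le_of_ne hd (Ne.symm h2)
      linarith
    have : 1 / (((d : ℝ) - 2) * (‖x‖ / 4) ^ (d - 2)) =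
        4 ^ (d - 2) * (1 / (((d : ℝ) - 2) * ‖x‖ ^ (d - 2))) := by
      rw [div_pow]; field_simp
    rw [this]
    gcongr
    · norm_num
    · omega

/-- The full interaction kernel. -/
def Fk (d : ℕ) (V : Euc d → ℝ) (w : Euc d × Euc d) : EReal :=
  coulombK d (w.1 - w.2) + (((V w.1 + V w.2) / 2 : ℝ) : EReal)

def Apos (d : ℕ) (V : Euc d → ℝ) (μ ν : Measure (Euc d)) : ℝ≥0∞ :=
  ∫⁻ w, (Fk d V w).toENNReal ∂(μ.prod ν)

def Bneg (d : ℕ) (V : Euc d → ℝ) (μ ν : Measure (Euc d)) : ℝ≥0∞ :=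
  ∫⁻ w, (-(Fk d V w)).toENNReal ∂(μ.prod ν)

theorem energy_eq (d : ℕ) (V : Euc d → ℝ) (μ : Measure (Euc d)) :
    energy d V μ = (Apos d V μ μ : EReal) - (Bneg d V μ μ : EReal) := by
  unfold energy Apos Bneg Fk
  simp only [posP_eq]

theorem g_lower {d : ℕ} (hd : 2 ≤ d) (x : Euc d) : ((-‖x‖ : ℝ) : EReal) ≤ coulombK d x := by
  unfold coulombK
  split_ifs with h h2
  · exact le_top
  · rw [EReal.coe_le_coe_iff, one_div, Real.log_inv]
    have := Real.log_le_self (norm_nonneg x)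
    linarith
  · rw [EReal.coe_le_coe_iff]
    have hd' : (0 : ℝ) < (d : ℝ) - 2 := by
      have : (2 : ℝ) < d := by exact_mod_cast lt_of_le_of_ne hd (Ne.symm h2)
      linarith
    have h1 : 0 ≤ 1 / (((d : ℝ) - 2) * ‖x‖ ^ (d - 2)) := by positivity
    have := norm_nonneg x
    linarith

theorem pow_bound (a q : ℝ) (ha : 0 < a) (hq : 1 < q) :
    ∃ C : ℝ, 0 ≤ C ∧ ∀ s : ℝ, 0 ≤ s → s ≤ a * s ^ q + C := by
  refine ⟨(1 / a) ^ (1 / (q - 1)), by positivity, fun s hs => ?_⟩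
  by_cases h : s ≤ (1 / a) ^ (1 / (q - 1))
  · have : 0 ≤ a * s ^ q := by positivity
    linarith
  · push Not at h
    have hT : 0 < (1 / a) ^ (1 / (q - 1)) := by positivity
    have hs' : 0 < s := hT.trans h
    have hq' : 0 < q - 1 := by linarith
    have h1 := Real.rpow_le_rpow hT.le h.le hq'.le
    rw [← Real.rpow_mul (by positivity), one_div_mul_cancel hq'.ne', Real.rpow_one] at h1
    have h2 : s ^ q = s ^ (q - 1) * s := by
      rw [← Real.rpow_add_one hs'.ne']; ring_nf
    rw [h2]
    have h3 : 1 ≤ a * s ^ (q - 1) := by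
      rw [div_le_iff₀ ha] at h1; linarith
    nlinarith

theorem F_lower {d : ℕ} (hd : 2 ≤ d) (V : Euc d → ℝ) (w : Euc d × Euc d) (u c : ℝ)
    (h : u ≤ -‖w.1 - w.2‖ + (V w.1 + V w.2) / 2 + c) : (u : EReal) ≤ Fk d V w + (c : EReal) := by
  refine (EReal.coe_le_coe_iff.2 h).trans ?_
  rw [EReal.coe_add, EReal.coe_add]
  unfold Fk
  gcongr
  exact g_lower hd _

theorem F_lower' {d : ℕ} (hd : 2 ≤ d) (V : Euc d → ℝ) (w : Euc d × Euc d) (u c : ℝ)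
    (h : u ≤ -‖w.1 - w.2‖ + (V w.1 + V w.2) / 2 + c) :
    ENNReal.ofReal u ≤ (Fk d V w).toENNReal + ENNReal.ofReal c := by
  have := EReal.toENNReal_le_toENNReal (F_lower hd V w u c h)
  exact this.trans EReal.toENNReal_add_le

theorem growth_low {d : ℕ} (V : Euc d → ℝ) (a q R : ℝ) (ha : 0 < a) (hq : 1 < q)
    (hg : GrowthCond d V a q R) : ∃ C : ℝ, 0 ≤ C ∧ ∀ w : Euc d × Euc d,
    a / 4 * (‖w.1‖ ^ q + ‖w.2‖ ^ q) ≤ -‖w.1 - w.2‖ + (V w.1 + V w.2) / 2 + C := by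
  obtain ⟨C, hC, h⟩ := pow_bound (a / 4) q (by positivity) hq
  refine ⟨2 * C + |R|, by positivity, fun w => ?_⟩
  have h1 := h _ (norm_nonneg w.1)
  have h2 := h _ (norm_nonneg w.2)
  have h3 := hg w.1
  have h4 := hg w.2
  have h5 := norm_sub_le w.1 w.2
  have h6 := le_abs_self R
  nlinarith

theorem V_low {d : ℕ} (V : Euc d → ℝ) (a q R : ℝ) (ha : 0 < a)
    (hg : GrowthCond d V a q R) (x : Euc d) : -R ≤ V x := by
  have h := hg x
  have : 0 ≤ a * ‖x‖ ^ q := by positivity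
  linarith

theorem measurable_Fk {d : ℕ} {V : Euc d → ℝ} (hV : Measurable V) : Measurable (Fk d V) := by
  unfold Fk
  have h1 : Measurable fun w : Euc d × Euc d => coulombK d (w.1 - w.2) :=
    (measurable_coulombK d).comp (by fun_prop)
  have h2 : Measurable fun w : Euc d × Euc d => (((V w.1 + V w.2) / 2 : ℝ) : EReal) :=
    (by fun_prop : Measurable fun w : Euc d × Euc d => (V w.1 + V w.2) / 2).coe_real_ereal
  exact h1.add h2

theorem lint_fst {d : ℕ} (μ ν : Measure (Euc d)) [IsProbabilityMeasure μ]
    [IsProbabilityMeasure ν] {f : Euc d → ℝ≥0∞} (hf : Measurable f) :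
    ∫⁻ w : Euc d × Euc d, f w.1 ∂(μ.prod ν) = ∫⁻ x, f x ∂μ :=
  (measurePreserving_fst (μ := μ) (ν := ν)).lintegral_comp hf

theorem lint_snd {d : ℕ} (μ ν : Measure (Euc d)) [IsProbabilityMeasure μ]
    [IsProbabilityMeasure ν] {f : Euc d → ℝ≥0∞} (hf : Measurable f) :
    ∫⁻ w : Euc d × Euc d, f w.2 ∂(μ.prod ν) = ∫⁻ x, f x ∂ν :=
  (measurePreserving_snd (μ := μ) (ν := ν)).lintegral_comp hf

theorem Bneg_fin {d : ℕ} (hd : 2 ≤ d) (V : Euc d → ℝ) (a q R : ℝ) (ha : 0 < a) (hq : 1 < q)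
    (hg : GrowthCond d V a q R) (μ ν : Measure (Euc d)) [IsProbabilityMeasure μ]
    [IsProbabilityMeasure ν] : Bneg d V μ ν ≠ ⊤ := by
  obtain ⟨C, hC, h⟩ := growth_low V a q R ha hq hg
  have hb : ∀ w, (-(Fk d V w)).toENNReal ≤ ENNReal.ofReal C := by
    intro w
    rw [← EReal.real_coe_toENNReal]
    apply EReal.toENNReal_le_toENNReal
    rw [EReal.neg_le, ← EReal.coe_neg]
    have h0 : 0 ≤ a / 4 * (‖w.1‖ ^ q + ‖w.2‖ ^ q) := by positivity
    have := F_lower hd V w (-C) 0 (by have := h w; linarith)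
    simpa using this
  refine ne_top_of_le_ne_top ?_ (lintegral_mono hb)
  simp

theorem energy_real {d : ℕ} (hd : 2 ≤ d) (V : Euc d → ℝ) (a q R : ℝ) (ha : 0 < a) (hq : 1 < q)
    (hg : GrowthCond d V a q R) (μ : Measure (Euc d)) [IsProbabilityMeasure μ]
    (hA : Apos d V μ μ ≠ ⊤) :
    energy d V μ = (((Apos d V μ μ).toReal - (Bneg d V μ μ).toReal : ℝ) : EReal) := by
  have hB := Bneg_fin hd V a q R ha hq hg μ μ
  rw [energy_eq, EReal.coe_sub, EReal.coe_ennreal_toReal hA, EReal.coe_ennreal_toReal hB]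

theorem Apos_fin {d : ℕ} (hd : 2 ≤ d) (V : Euc d → ℝ) (a q R : ℝ) (ha : 0 < a) (hq : 1 < q)
    (hg : GrowthCond d V a q R) (μ : Measure (Euc d)) [IsProbabilityMeasure μ]
    (hE : energy d V μ ≠ ⊤) : Apos d V μ μ ≠ ⊤ := by
  have hB := Bneg_fin hd V a q R ha hq hg μ μ
  intro hA
  apply hE
  rw [energy_eq, hA, ← EReal.coe_ennreal_toReal hB]
  simp

theorem moment_q {d : ℕ} (hd : 2 ≤ d) (V : Euc d → ℝ) (a q R : ℝ)
    (ha : 0 < a) (hq : 1 < q)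
    (hg : GrowthCond d V a q R) (μ : Measure (Euc d)) [IsProbabilityMeasure μ]
    (hA : Apos d V μ μ ≠ ⊤) : FiniteMoment d q μ := by
  obtain ⟨C, hC, h⟩ := growth_low V a q R ha hq hg
  unfold FiniteMoment
  have hm : Measurable fun x : Euc d => ENNReal.ofReal (‖x‖ ^ q) := by fun_prop
  have hb : ∀ w : Euc d × Euc d, ENNReal.ofReal (a / 4) * ENNReal.ofReal (‖w.1‖ ^ q) ≤
      (Fk d V w).toENNReal + ENNReal.ofReal C := by
    intro w
    rw [← ENNReal.ofReal_mul (by positivity)]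
    apply F_lower' hd
    refine le_trans ?_ (h w)
    have : 0 ≤ ‖w.2‖ ^ q := by positivity
    gcongr
    linarith
  have h2 := lintegral_mono (μ := μ.prod μ) hb
  rw [lintegral_const_mul _ (by fun_prop), lint_fst μ μ hm,
    lintegral_add_right _ measurable_const] at h2
  intro htop
  rw [htop, ENNReal.mul_top (by simpa using ha)] at h2
  have : Apos d V μ μ + ENNReal.ofReal C ≠ ⊤ := by simp [hA]
  apply this
  simpa [Apos] using h2

theorem moment_lower {d : ℕ} (p q : ℝ) (hp : 0 ≤ p) (hpq : p ≤ q) (μ : Measure (Euc d))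
    [IsProbabilityMeasure μ] (h : FiniteMoment d q μ) : FiniteMoment d p μ := by
  unfold FiniteMoment at *
  have hb : ∀ x : Euc d, ENNReal.ofReal (‖x‖ ^ p) ≤ ENNReal.ofReal (‖x‖ ^ q) + 1 := by
    intro x
    rw [← ENNReal.ofReal_one, ← ENNReal.ofReal_add (by positivity) (by norm_num)]
    apply ENNReal.ofReal_le_ofReal
    rcases le_total ‖x‖ 1 with h1 | h1
    · have := Real.rpow_le_one (norm_nonneg x) h1 hp
      have : 0 ≤ ‖x‖ ^ q := by positivity
      linarith
    · have := Real.rpow_le_rpow_of_exponent_le h1 hpq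
      linarith
  refine ne_top_of_le_ne_top ?_ (lintegral_mono hb)
  rw [lintegral_add_right _ measurable_const]
  simp [h]

theorem V_fin {d : ℕ} (hd : 2 ≤ d) (V : Euc d → ℝ) (hV : Measurable V) (a q R : ℝ)
    (ha : 0 < a) (hq : 1 < q)
    (hg : GrowthCond d V a q R) (μ : Measure (Euc d)) [IsProbabilityMeasure μ]
    (hA : Apos d V μ μ ≠ ⊤) : ∫⁻ x, ENNReal.ofReal ((V x + R) / 2) ∂μ ≠ ⊤ := by
  have h1 : ∫⁻ x : Euc d, ENNReal.ofReal ‖x‖ ∂μ ≠ ⊤ := by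
    have := moment_lower 1 q zero_le_one hq.le μ (moment_q hd V a q R ha hq hg μ hA)
    simpa [FiniteMoment] using this
  have hm1 : Measurable fun x : Euc d => ENNReal.ofReal ‖x‖ := by fun_prop
  have hm2 : Measurable fun x : Euc d => ENNReal.ofReal ((V x + R) / 2) := by fun_prop
  have hb : ∀ w : Euc d × Euc d, ENNReal.ofReal ((V w.1 + R) / 2) ≤
      (Fk d V w).toENNReal + (ENNReal.ofReal ‖w.1‖ + (ENNReal.ofReal ‖w.2‖ +
        ENNReal.ofReal |R|)) := by
    intro w
    rw [← ENNReal.ofReal_add (by positivity) (by positivity),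
      ← ENNReal.ofReal_add (by positivity) (by positivity)]
    apply F_lower' hd
    have h5 := norm_sub_le w.1 w.2
    have h6 := le_abs_self R
    have h7 := V_low V a q R ha hg w.2
    linarith
  rw [← lint_fst μ μ hm2]
  refine ne_top_of_le_ne_top ?_ (lintegral_mono hb)
  rw [lintegral_add_right _ (by fun_prop), lintegral_add_right _ (by fun_prop),
    lintegral_add_right _ measurable_const, lint_fst μ μ hm1, lint_snd μ μ hm1]
  unfold Apos at hA
  refine ENNReal.add_ne_top.2 ⟨hA, ENNReal.add_ne_top.2 ⟨h1, ENNReal.add_ne_top.2 ⟨h1, by simp⟩⟩⟩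

theorem g_fin {d : ℕ} (hd : 2 ≤ d) (V : Euc d → ℝ) (a q R : ℝ)
    (ha : 0 < a)
    (hg : GrowthCond d V a q R) (μ : Measure (Euc d)) [IsProbabilityMeasure μ]
    (hA : Apos d V μ μ ≠ ⊤) :
    ∫⁻ w : Euc d × Euc d, (coulombK d ((1/4 : ℝ) • (w.1 - w.2))).toENNReal ∂(μ.prod μ) ≠ ⊤ := by
  have hb : ∀ w : Euc d × Euc d, (coulombK d (w.1 - w.2)).toENNReal ≤
      (Fk d V w).toENNReal + ENNReal.ofReal |R| := by
    intro w
    have h6 := le_abs_self R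
    have h7 := V_low V a q R ha hg w.2
    have h8 := V_low V a q R ha hg w.1
    have : coulombK d (w.1 - w.2) ≤ Fk d V w + ((|R| : ℝ) : EReal) := by
      unfold Fk
      rw [add_assoc, ← EReal.coe_add]
      apply le_add_of_nonneg_right
      exact_mod_cast (by linarith : 0 ≤ (V w.1 + V w.2) / 2 + |R|)
    exact (EReal.toENNReal_le_toENNReal this).trans EReal.toENNReal_add_le
  have h1 : ∫⁻ w : Euc d × Euc d, (coulombK d (w.1 - w.2)).toENNReal ∂(μ.prod μ) ≠ ⊤ := by
    refine ne_top_of_le_ne_top ?_ (lintegral_mono hb)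
    rw [lintegral_add_right _ measurable_const]
    unfold Apos at hA
    simp [hA]
  refine ne_top_of_le_ne_top ?_ (lintegral_mono fun w => scale_g hd (w.1 - w.2))
  rw [lintegral_add_right _ measurable_const, lintegral_const_mul' _ _ (by simp)]
  refine ENNReal.add_ne_top.2 ⟨ENNReal.mul_ne_top (by simp) h1, by simp⟩

theorem cross_fin {d : ℕ} (hd : 2 ≤ d) (V : Euc d → ℝ) (hV : Measurable V) (a q R : ℝ)
    (ha : 0 < a) (hq : 1 < q)
    (hg : GrowthCond d V a q R) (μ ν : Measure (Euc d)) [IsProbabilityMeasure μ]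
    [IsProbabilityMeasure ν]
    (hA : Apos d V μ μ ≠ ⊤) (hA' : Apos d V ν ν ≠ ⊤) : Apos d V μ ν ≠ ⊤ := by
  have hm2 : Measurable fun x : Euc d => ENNReal.ofReal ((V x + R) / 2) := by fun_prop
  have h1 : ∫⁻ w : Euc d × Euc d, (coulombK d (w.1 - w.2)).toENNReal ∂(μ.prod ν) ≠ ⊤ := by
    refine ne_top_of_le_ne_top ?_ (cross_g hd μ ν)
    exact ENNReal.mul_ne_top (by simp) (ENNReal.add_ne_top.2
      ⟨g_fin hd V a q R ha hg μ hA, g_fin hd V a q R ha hg ν hA'⟩)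
  have h2 := V_fin hd V hV a q R ha hq hg μ hA
  have h3 := V_fin hd V hV a q R ha hq hg ν hA'
  have hb : ∀ w : Euc d × Euc d, (Fk d V w).toENNReal ≤ (coulombK d (w.1 - w.2)).toENNReal +
      (ENNReal.ofReal ((V w.1 + R) / 2) + (ENNReal.ofReal ((V w.2 + R) / 2) +
        ENNReal.ofReal |R|)) := by
    intro w
    refine EReal.toENNReal_add_le.trans ?_
    gcongr
    have h6 := neg_abs_le R
    have h7 := V_low V a q R ha hg w.2
    have h8 := V_low V a q R ha hg w.1
    rw [← ENNReal.ofReal_add (by linarith) (by positivity),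
      ← ENNReal.ofReal_add (by linarith) (by linarith [abs_nonneg R]), EReal.real_coe_toENNReal]
    apply ENNReal.ofReal_le_ofReal
    linarith
  unfold Apos
  refine ne_top_of_le_ne_top ?_ (lintegral_mono hb)
  rw [lintegral_add_right _ (by fun_prop), lintegral_add_right _ (by fun_prop),
    lintegral_add_right _ measurable_const, lint_fst μ ν hm2, lint_snd μ ν hm2]
  simp [h1, h2, h3]

/-- Convex combination of two measures. -/
def mix {d : ℕ} (t : ℝ) (μ ν : Measure (Euc d)) : Measure (Euc d) :=
  ENNReal.ofReal (1 - t) • μ + ENNReal.ofReal t • ν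

theorem mix_prob {d : ℕ} (t : ℝ) (h0 : 0 < t) (h1 : t < 1) (μ ν : Measure (Euc d))
    [IsProbabilityMeasure μ] [IsProbabilityMeasure ν] : IsProbabilityMeasure (mix t μ ν) := by
  constructor
  unfold mix
  simp only [Measure.coe_add, Measure.coe_smul, Pi.add_apply, Pi.smul_apply, measure_univ,
    smul_eq_mul, mul_one]
  rw [← ENNReal.ofReal_add (by linarith) h0.le]
  simp

theorem mix_lint {d : ℕ} (t : ℝ) (μ ν : Measure (Euc d))
    [IsProbabilityMeasure μ] [IsProbabilityMeasure ν] (f : Euc d × Euc d → ℝ≥0∞) :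
    ∫⁻ w, f w ∂((mix t μ ν).prod (mix t μ ν)) =
      ENNReal.ofReal (1 - t) * (ENNReal.ofReal (1 - t) * ∫⁻ w, f w ∂(μ.prod μ)) +
      ENNReal.ofReal (1 - t) * (ENNReal.ofReal t * ∫⁻ w, f w ∂(μ.prod ν)) +
      (ENNReal.ofReal t * (ENNReal.ofReal (1 - t) * ∫⁻ w, f w ∂(ν.prod μ)) +
      ENNReal.ofReal t * (ENNReal.ofReal t * ∫⁻ w, f w ∂(ν.prod ν))) := by
  unfold mix
  have : IsFiniteMeasure (ENNReal.ofReal (1 - t) • μ) := Measure.smul_finite _ ENNReal.ofReal_ne_top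
  have : IsFiniteMeasure (ENNReal.ofReal t • ν) := Measure.smul_finite _ ENNReal.ofReal_ne_top
  rw [Measure.add_prod, Measure.prod_add, Measure.prod_add]
  simp only [Measure.prod_smul_left, Measure.prod_smul_right, lintegral_add_measure,
    lintegral_smul_measure, smul_eq_mul]
  ring

theorem mix_energy {d : ℕ} (hd : 2 ≤ d) (V : Euc d → ℝ) (hV : Measurable V) (a q R : ℝ)
    (ha : 0 < a) (hq : 1 < q)
    (hg : GrowthCond d V a q R) (μ ν : Measure (Euc d)) [IsProbabilityMeasure μ]
    [IsProbabilityMeasure ν]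
    (hA : Apos d V μ μ ≠ ⊤) (hA' : Apos d V ν ν ≠ ⊤) :
    ∃ e M : ℝ, energy d V μ = (e : EReal) ∧ ∀ t : ℝ, 0 < t → t < 1 →
      energy d V (mix t μ ν) ≤ ((e + t * M : ℝ) : EReal) := by
  have h1 := cross_fin hd V hV a q R ha hq hg μ ν hA hA'
  have h2 := cross_fin hd V hV a q R ha hq hg ν μ hA' hA
  have hB := Bneg_fin hd V a q R ha hq hg μ μ
  refine ⟨_, (Apos d V μ ν).toReal + (Apos d V ν μ).toReal + (Apos d V ν ν).toReal +
    2 * (Bneg d V μ μ).toReal, energy_real hd V a q R ha hq hg μ hA, fun t h0 ht1 => ?_⟩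
  have := mix_prob t h0 ht1 μ ν
  have hBt := Bneg_fin hd V a q R ha hq hg (mix t μ ν) (mix t μ ν)
  have eA : Apos d V (mix t μ ν) (mix t μ ν) = _ := mix_lint t μ ν fun w => (Fk d V w).toENNReal
  have eB : Bneg d V (mix t μ ν) (mix t μ ν) = _ :=
    mix_lint t μ ν fun w => (-(Fk d V w)).toENNReal
  change _ = ENNReal.ofReal (1 - t) * (ENNReal.ofReal (1 - t) * Apos d V μ μ) +
      ENNReal.ofReal (1 - t) * (ENNReal.ofReal t * Apos d V μ ν) +
      (ENNReal.ofReal t * (ENNReal.ofReal (1 - t) * Apos d V ν μ) +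
      ENNReal.ofReal t * (ENNReal.ofReal t * Apos d V ν ν)) at eA
  have fA : Apos d V (mix t μ ν) (mix t μ ν) ≠ ⊤ := by
    rw [eA]
    simp [ENNReal.mul_ne_top, ENNReal.add_ne_top, hA, hA', h1, h2]
  have gB : ENNReal.ofReal (1 - t) * (ENNReal.ofReal (1 - t) * Bneg d V μ μ) ≤
      Bneg d V (mix t μ ν) (mix t μ ν) := by
    rw [eB, add_assoc]
    exact le_self_add
  have rB := ENNReal.toReal_mono hBt gB
  rw [ENNReal.toReal_mul, ENNReal.toReal_mul, ENNReal.toReal_ofReal (by linarith)] at rB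
  rw [energy_real hd V a q R ha hq hg (mix t μ ν) fA, EReal.coe_le_coe_iff, eA]
  have n1 : ENNReal.ofReal (1 - t) ≠ ⊤ := ENNReal.ofReal_ne_top
  have n2 : ENNReal.ofReal t ≠ ⊤ := ENNReal.ofReal_ne_top
  rw [ENNReal.toReal_add (by finiteness) (by finiteness),
    ENNReal.toReal_add (by finiteness) (by finiteness),
    ENNReal.toReal_add (by finiteness) (by finiteness)]
  simp only [ENNReal.toReal_mul]
  rw [ENNReal.toReal_ofReal (by linarith), ENNReal.toReal_ofReal h0.le]
  generalize (Bneg d V (mix t μ ν) (mix t μ ν)).toReal = bt at *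
  have p1 : 0 ≤ (Apos d V μ μ).toReal := ENNReal.toReal_nonneg
  have p2 : 0 ≤ (Apos d V μ ν).toReal := ENNReal.toReal_nonneg
  have p3 : 0 ≤ (Apos d V ν μ).toReal := ENNReal.toReal_nonneg
  have p4 : 0 ≤ (Apos d V ν ν).toReal := ENNReal.toReal_nonneg
  have p5 : 0 ≤ (Bneg d V μ μ).toReal := ENNReal.toReal_nonneg
  generalize (Apos d V μ μ).toReal = x1 at *
  generalize (Apos d V μ ν).toReal = x2 at *
  generalize (Apos d V ν μ).toReal = x3 at *
  generalize (Apos d V ν ν).toReal = x4 at *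
  generalize (Bneg d V μ μ).toReal = b at *
  have k1 : (1 - t) * ((1 - t) * x1) ≤ x1 := by
    nlinarith [mul_nonneg h0.le p1, mul_nonneg (mul_nonneg h0.le p1) (by linarith : 0 ≤ 1 - t)]
  have k2 : (1 - t) * (t * x2) ≤ t * x2 := by nlinarith [mul_nonneg h0.le p2]
  have k3 : t * ((1 - t) * x3) ≤ t * x3 := by
    nlinarith [mul_nonneg h0.le p3, mul_nonneg (mul_nonneg h0.le p3) h0.le]
  have k4 : t * (t * x4) ≤ t * x4 := by
    nlinarith [mul_nonneg h0.le p4, mul_nonneg (mul_nonneg h0.le p4) (by linarith : 0 ≤ 1 - t)]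
  have k5 : b - 2 * t * b ≤ (1 - t) * ((1 - t) * b) := by
    nlinarith [mul_nonneg (mul_nonneg h0.le h0.le) p5]
  linarith

theorem lip_integrable {d : ℕ} {p : ℝ} (hp1 : 1 < p) {φ : Euc d → ℝ} {K : ℝ≥0}
    (hφ : LipschitzWith K φ) {μ : Measure (Euc d)} (hμ : μ ∈ Ppd d p) : Integrable φ μ := by
  obtain ⟨hprob, hm⟩ := hμ
  have h1 := moment_lower 1 p zero_le_one hp1.le μ hm
  have hn : Integrable (fun x : Euc d => ‖x‖) μ := by
    refine ⟨by fun_prop, ?_⟩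
    rw [hasFiniteIntegral_iff_ofReal (Eventually.of_forall fun x => norm_nonneg x)]
    unfold FiniteMoment at h1
    simp only [Real.rpow_one] at h1
    exact lt_top_iff_ne_top.2 h1
  have hbd : Integrable (fun x : Euc d => |φ 0| + K * ‖x‖) μ :=
    (integrable_const _).add (hn.const_mul _)
  refine hbd.mono' hφ.continuous.measurable.aestronglyMeasurable (Eventually.of_forall fun x => ?_)
  have := hφ.dist_le_mul x 0
  rw [dist_zero_right, Real.dist_eq] at this
  rw [Real.norm_eq_abs]
  have h3 := abs_sub_abs_le_abs_sub (φ x) (φ 0)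
  linarith

theorem wass_lip {d : ℕ} {p : ℝ} (hp1 : 1 < p) {φ : Euc d → ℝ} {K : ℝ≥0}
    (hφ : LipschitzWith K φ) {μ ν : Measure (Euc d)} (hμ : μ ∈ Ppd d p) (hν : ν ∈ Ppd d p)
    {ε : ℝ} (hε : 0 < ε) (hW : wassDist d p μ ν < ENNReal.ofReal ε) :
    |∫ x, φ x ∂μ - ∫ x, φ x ∂ν| ≤ K * ε := by
  have hp0 : 0 < p := by linarith
  have iμ := lip_integrable hp1 hφ hμ
  have iν := lip_integrable hp1 hφ hν
  have := hμ.1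
  unfold wassDist at hW
  have hW2 := ENNReal.rpow_lt_rpow hW hp0
  rw [← ENNReal.rpow_mul, one_div_mul_cancel hp0.ne', ENNReal.rpow_one] at hW2
  obtain ⟨π, hπ⟩ := iInf_lt_iff.1 hW2
  obtain ⟨⟨h1, h2⟩, hlt⟩ := iInf_lt_iff.1 hπ
  have : IsProbabilityMeasure π := by
    constructor
    have := congrArg (fun m => m Set.univ) h1
    rw [Measure.map_apply measurable_fst MeasurableSet.univ] at this
    simpa using this
  have mφ : Measurable φ := hφ.continuous.measurable
  have iμ' : Integrable (fun w : Euc d × Euc d => φ w.1) π := by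
    rw [← h1] at iμ
    exact iμ.comp_measurable measurable_fst
  have iν' : Integrable (fun w : Euc d × Euc d => φ w.2) π := by
    rw [← h2] at iν
    exact iν.comp_measurable measurable_snd
  have e1 : ∫ x, φ x ∂μ = ∫ w, φ w.1 ∂π := by
    rw [← h1, integral_map measurable_fst.aemeasurable mφ.aestronglyMeasurable]
  have e2 : ∫ x, φ x ∂ν = ∫ w, φ w.2 ∂π := by
    rw [← h2, integral_map measurable_snd.aemeasurable mφ.aestronglyMeasurable]
  rw [e1, e2, ← integral_sub iμ' iν']
  have hLp := eLpNorm'_le_eLpNorm'_of_exponent_le (f := fun w : Euc d × Euc d => w.1 - w.2)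
    one_pos hp1.le π (by fun_prop)
  unfold eLpNorm' at hLp
  simp only [ENNReal.rpow_one, div_one] at hLp
  have hp_int : ∫⁻ w : Euc d × Euc d, ‖w.1 - w.2‖ₑ ^ p ∂π ≤ ENNReal.ofReal ε ^ p := by
    refine le_trans (le_of_eq ?_) hlt.le
    congr 1
    ext w
    rw [← ofReal_norm, ENNReal.ofReal_rpow_of_nonneg (norm_nonneg _) hp0.le]
  have hp_int2 : (∫⁻ w : Euc d × Euc d, ‖w.1 - w.2‖ₑ ^ p ∂π) ^ (1 / p) ≤ ENNReal.ofReal ε := by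
    refine (ENNReal.rpow_le_rpow hp_int (by positivity)).trans_eq ?_
    rw [← ENNReal.rpow_mul, mul_one_div_cancel hp0.ne', ENNReal.rpow_one]
  have main : ‖∫ w, (φ w.1 - φ w.2) ∂π‖ₑ ≤ ENNReal.ofReal (K * ε) := by
    refine (enorm_integral_le_lintegral_enorm _).trans ?_
    have hb : ∀ w : Euc d × Euc d, ‖φ w.1 - φ w.2‖ₑ ≤ (K : ℝ≥0∞) * ‖w.1 - w.2‖ₑ := by
      intro w
      have := hφ w.1 w.2
      rwa [edist_eq_enorm_sub, edist_eq_enorm_sub] at this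
    refine (lintegral_mono hb).trans ?_
    rw [lintegral_const_mul' _ _ ENNReal.coe_ne_top, ENNReal.ofReal_mul K.coe_nonneg,
      ENNReal.ofReal_coe_nnreal]
    gcongr
    exact hLp.trans hp_int2
  rw [← ofReal_norm, ENNReal.ofReal_le_ofReal_iff (by positivity)] at main
  exact main

theorem mix_mem {d : ℕ} {p : ℝ} (t : ℝ) (h0 : 0 < t) (h1 : t < 1) {μ ν : Measure (Euc d)}
    (hμ : μ ∈ Ppd d p) (hν : ν ∈ Ppd d p) : mix t μ ν ∈ Ppd d p := by
  have := hμ.1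
  have := hν.1
  refine ⟨mix_prob t h0 h1 μ ν, ?_⟩
  have a1 := hμ.2
  have a2 := hν.2
  unfold FiniteMoment at *
  unfold mix
  rw [lintegral_add_measure, lintegral_smul_measure, lintegral_smul_measure]
  simp only [smul_eq_mul]
  finiteness

theorem mix_integral {d : ℕ} (t : ℝ) (h0 : 0 < t) (h1 : t < 1) {μ ν : Measure (Euc d)}
    {φ : Euc d → ℝ} (hμ : Integrable φ μ) (hν : Integrable φ ν) :
    ∫ x, φ x ∂(mix t μ ν) = (1 - t) * ∫ x, φ x ∂μ + t * ∫ x, φ x ∂ν := by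
  unfold mix
  rw [integral_add_measure (hμ.smul_measure ENNReal.ofReal_ne_top)
    (hν.smul_measure ENNReal.ofReal_ne_top), integral_smul_measure, integral_smul_measure,
    ENNReal.toReal_ofReal (by linarith), ENNReal.toReal_ofReal h0.le]
  simp

theorem interior_of_neg {d : ℕ} {p : ℝ} (hp1 : 1 < p) {φ : Euc d → ℝ} {K : ℝ≥0}
    (hφ : LipschitzWith K φ) {μ : Measure (Euc d)} (hμ : μ ∈ Ppd d p)
    (hneg : ∫ x, φ x ∂μ < 0) :
    μ ∈ wInterior d p {ν | ν ∈ Ppd d p ∧ ∫ x, φ x ∂ν ≤ 0} := by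
  refine ⟨⟨hμ, hneg.le⟩, (-∫ x, φ x ∂μ) / (K + 1), by have := K.coe_nonneg; apply div_pos <;> linarith,
    fun ν hν hW => ⟨hν, ?_⟩⟩
  have hK := K.coe_nonneg
  have hε : 0 < (-∫ x, φ x ∂μ) / ((K : ℝ) + 1) := by apply div_pos <;> linarith
  have h := wass_lip hp1 hφ hμ hν hε hW
  have h2 : (K : ℝ) * ((-∫ x, φ x ∂μ) / ((K : ℝ) + 1)) ≤ -∫ x, φ x ∂μ := by
    rw [← mul_div_assoc, div_le_iff₀ (by linarith)]
    nlinarith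
  have := (abs_le.1 h).1
  linarith

/-- for a Lipschitz non-constant constraint function `φ` admitting finite-energy
measures with negative and positive means, the set `B = {ν ∈ P_p : ν(φ) ≤ 0}` is closed in
the `p`-Wasserstein topology and is an `I`-continuity set for the electrostatic energy. -/
theorem stmt9 (d : ℕ) (hd : 2 ≤ d) (V : Euc d → ℝ) (hVlsc : LowerSemicontinuous V)
    (a q R : ℝ) (ha : 0 < a) (hq : 1 < q) (hgrowth : GrowthCond d V a q R)
    (p : ℝ) (hp1 : 1 < p) (hpq : p < q)
    (φ : Euc d → ℝ) (hφLip : ∃ K : ℝ≥0, LipschitzWith K φ)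
    (hφnc : ∃ x y : Euc d, φ x ≠ φ y)
    (μm : Measure (Euc d)) (hμm : IsProbabilityMeasure μm) (hμmE : energy d V μm ≠ ⊤)
    (hμmφ : ∫ x, φ x ∂μm < 0)
    (μp : Measure (Euc d)) (hμp : IsProbabilityMeasure μp) (hμpE : energy d V μp ≠ ⊤)
    (hμpφ : 0 < ∫ x, φ x ∂μp) :
    WClosedIn d p {ν | ν ∈ Ppd d p ∧ ∫ x, φ x ∂ν ≤ 0} ∧
    (⨅ μ ∈ wInterior d p {ν | ν ∈ Ppd d p ∧ ∫ x, φ x ∂ν ≤ 0}, energy d V μ)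
      = (⨅ μ ∈ {ν | ν ∈ Ppd d p ∧ ∫ x, φ x ∂ν ≤ 0}, energy d V μ) ∧
    (⨅ μ ∈ {ν | ν ∈ Ppd d p ∧ ∫ x, φ x ∂ν ≤ 0}, energy d V μ) ≠ ⊤ := by
  obtain ⟨K, hK⟩ := hφLip
  have hV : Measurable V := hVlsc.measurable
  have hAm := Apos_fin hd V a q R ha hq hgrowth μm hμmE
  have hmP : μm ∈ Ppd d p := ⟨hμm, moment_lower p q (by linarith) hpq.le μm
    (moment_q hd V a q R ha hq hgrowth μm hAm)⟩
  refine ⟨?_, le_antisymm ?_ ?_, ?_⟩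
  · intro μ hμ h
    refine ⟨hμ, ?_⟩
    by_contra hpos
    push Not at hpos
    have hK0 := K.coe_nonneg
    have hε : 0 < (∫ x, φ x ∂μ) / 2 / ((K : ℝ) + 1) := by positivity
    obtain ⟨ν, ⟨hν, hνφ⟩, hW⟩ := h _ hε
    have h1 := wass_lip hp1 hK hμ hν hε hW
    have h2 : (K : ℝ) * ((∫ x, φ x ∂μ) / 2 / ((K : ℝ) + 1)) ≤ (∫ x, φ x ∂μ) / 2 := by
      rw [← mul_div_assoc, div_le_iff₀ (by linarith)]
      nlinarith
    have := (abs_le.1 h1).2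
    linarith
  · refine le_iInf₂ fun μ hμ => ?_
    obtain ⟨hμP, hμφ⟩ := hμ
    by_cases hE : energy d V μ = ⊤
    · rw [hE]; exact le_top
    have := hμP.1
    have hA := Apos_fin hd V a q R ha hq hgrowth μ hE
    obtain ⟨e, M, he, hmix⟩ := mix_energy hd V hV a q R ha hq hgrowth μ μm hA hAm
    rw [he]
    have hlim : Tendsto (fun t : ℝ => ((e + t * M : ℝ) : EReal)) (𝓝[>] 0) (𝓝 (e : EReal)) := by
      have hc : Continuous fun t : ℝ => ((e + t * M : ℝ) : EReal) :=
        continuous_coe_real_ereal.comp (by fun_prop)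
      have := (hc.tendsto 0).mono_left (nhdsWithin_le_nhds (s := Set.Ioi 0))
      simpa using this
    refine ge_of_tendsto hlim ?_
    filter_upwards [Ioo_mem_nhdsGT (zero_lt_one (α := ℝ))] with t ht
    refine le_trans (iInf₂_le (mix t μ μm) ?_) (hmix t ht.1 ht.2)
    refine interior_of_neg hp1 hK (mix_mem t ht.1 ht.2 hμP hmP) ?_
    rw [mix_integral t ht.1 ht.2 (lip_integrable hp1 hK hμP) (lip_integrable hp1 hK hmP)]
    have h1 := mul_neg_of_pos_of_neg ht.1 hμmφ
    linarith [h1, mul_nonpos_of_nonneg_of_nonpos (by linarith [ht.2] : (0 : ℝ) ≤ 1 - t) hμφ]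
  · exact le_iInf₂ fun μ hμ => iInf₂_le μ hμ.1
  · exact ne_top_of_le_ne_top hμmE (iInf₂_le μm ⟨hmP, hμmφ.le⟩)

end
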